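/- Let c1,c2,c3 ∈ ℝ satisfy |c3| > |c1| > 0, |c3| > |c2| > 0, and |c1| ≠ |c2|, and define f(γ) = mid(|c1|(1−γ), |c2|(1−γ), |c3|(1−γ)²) for γ ∈ [0,1] (the 1-norm geometric discord of a Bell-diagonal state with correlation vector (c1,c2,c3) evolved under the generalized amplitude damping channel at p = 1/2). Set γ1 = 1 − max(|c1|,|c2|)/|c3| and γ2 = 1 − min(|c1|,|c2|)/|c3|. Then 0 < γ1 < γ2 < 1, and f(γ) = max(|c1|,|c2|)·(1−γ) for γ ∈ [0,γ1], f(γ) = |c3|·(1−γ)² for γ ∈ [γ1,γ2], and f(γ) = min(|c1|,|c2|)·(1−γ) for γ ∈ [γ2,1] (double sudden change). -/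

import Mathlib

/-- The intermediate (median) value of three reals. -/
noncomputable def mid (a b c : ℝ) : ℝ := a + b + c - max a (max b c) - min a (min b c)

theorem mid_swap_left (a b c : ℝ) : mid a b c = mid b a c := by
  unfold mid
  rw [max_left_comm, min_left_comm]
  ring

theorem mid_swap_right (a b c : ℝ) : mid a b c = mid a c b := by
  unfold mid
  rw [max_comm b c, min_comm b c]
  ring

theorem mid_eq_of_le_of_le {a b c : ℝ} (hab : a ≤ b) (hbc : b ≤ c) : mid a b c = b := by
  unfold mid
  rw [max_eq_right hbc, min_eq_left hbc, max_eq_right (hab.trans hbc), min_eq_left hab]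
  ring

theorem mid_mul_max_min (a b x y : ℝ) :
    mid (a * x) (b * x) y = mid (min a b * x) (max a b * x) y := by
  rcases le_total a b with h | h
  · rw [min_eq_left h, max_eq_right h]
  · rw [min_eq_right h, max_eq_left h, mid_swap_left]

/-- Double sudden change of the 1-norm geometric discord of a Bell-diagonal state under the
generalized amplitude damping channel at `p = 1/2`. -/
theorem gad_doubleSuddenChange (c₁ c₂ c₃ : ℝ)
    (h₁ : 0 < |c₁|) (h₂ : 0 < |c₂|) (h₃ : |c₁| < |c₃|) (h₄ : |c₂| < |c₃|) (h₅ : |c₁| ≠ |c₂|)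
    (f : ℝ → ℝ) (hf : ∀ γ, f γ = mid (|c₁| * (1 - γ)) (|c₂| * (1 - γ)) (|c₃| * (1 - γ) ^ 2))
    (γ₁ γ₂ : ℝ) (hγ₁ : γ₁ = 1 - max |c₁| |c₂| / |c₃|)
    (hγ₂ : γ₂ = 1 - min |c₁| |c₂| / |c₃|) :
    0 < γ₁ ∧ γ₁ < γ₂ ∧ γ₂ < 1 ∧
    (∀ γ ∈ Set.Icc (0 : ℝ) γ₁, f γ = max |c₁| |c₂| * (1 - γ)) ∧
    (∀ γ ∈ Set.Icc γ₁ γ₂, f γ = |c₃| * (1 - γ) ^ 2) ∧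
    (∀ γ ∈ Set.Icc γ₂ (1 : ℝ), f γ = min |c₁| |c₂| * (1 - γ)) := by
  have hC : 0 < |c₃| := h₁.trans h₃
  have hm : 0 < min |c₁| |c₂| := lt_min h₁ h₂
  have hmM : min |c₁| |c₂| < max |c₁| |c₂| := min_lt_max.mpr h₅
  have hMC : max |c₁| |c₂| < |c₃| := max_lt h₃ h₄
  simp only [mid_mul_max_min |c₁| |c₂|] at hf
  generalize min |c₁| |c₂| = m at *
  generalize max |c₁| |c₂| = M at *
  generalize |c₃| = C at *
  have hM1 : M / C < 1 := (div_lt_one hC).mpr hMC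
  have hm0 : 0 < m / C := div_pos hm hC
  have hdiv : m / C < M / C := div_lt_div_of_pos_right hmM hC
  have le_sq {a x : ℝ} (hx : 0 ≤ x) (h : a / C ≤ x) : a * x ≤ C * x ^ 2 := by
    have := mul_le_mul_of_nonneg_right ((div_le_iff₀' hC).mp h) hx
    linarith
  have sq_le {a x : ℝ} (hx : 0 ≤ x) (h : x ≤ a / C) : C * x ^ 2 ≤ a * x := by
    have := mul_le_mul_of_nonneg_right ((le_div_iff₀' hC).mp h) hx
    linarith
  refine ⟨by linarith, by linarith, by linarith, ?_, ?_, ?_⟩ <;>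
    rintro γ ⟨hl, hr⟩ <;>
    have hx : 0 ≤ 1 - γ := by linarith
  · rw [hf]
    exact mid_eq_of_le_of_le (mul_le_mul_of_nonneg_right hmM.le hx) (le_sq hx (by linarith))
  · rw [hf, mid_swap_right]
    exact mid_eq_of_le_of_le (le_sq hx (by linarith)) (sq_le hx (by linarith))
  · rw [hf, mid_swap_right, mid_swap_left]
    exact mid_eq_of_le_of_le (sq_le hx (by linarith)) (mul_le_mul_of_nonneg_right hmM.le hx)
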